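/- arXiv:1311.1792 — 3 statements merged into one kernel-verified Lean document; each statement's English description precedes it below -/
import Mathlib

section
/- Let C = (c₁,c₂) be a pair of homogeneous polynomials in ℂ[t₁,t₂] of equal degree, not both zero, with no common zero in ℂ² \ {(0,0)} (the homogeneous lift of a marked point c ∈ ℂ(t) ∪ {∞}, where c = ∞ corresponds to c₂ = 0). Then the point (c₁(t,1), c₂(t,1)) is preperiodic for F_t for every t ∈ ℂ \ {0,1} if and only if c₁ = 0, or c₂ = 0, or c₁ = c₂, or t₂·c₁ = t₁·c₂ (i.e. the marked point c equals 0, ∞, 1, or t). (Proposition 1.4.) -/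
open MvPolynomial

/-- The degree-4 homogeneous lift `F_{t₁,t₂}(z,w) = ((t₁w² − t₂z²)², 4t₂zw(w−z)(t₁w − t₂z))`
of the Lattès map `f_t(z) = (z²−t)²/(4z(z−1)(z−t))`. -/
def LattesLift (t₁ t₂ : ℂ) (p : ℂ × ℂ) : ℂ × ℂ :=
  ((t₁ * p.2 ^ 2 - t₂ * p.1 ^ 2) ^ 2,
    4 * t₂ * p.1 * p.2 * (p.2 - p.1) * (t₁ * p.2 - t₂ * p.1))

/-- A point `(z,w) ∈ ℂ² \ {(0,0)}` is preperiodic for `F_t = F_{t,1}` if there are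
`0 ≤ m < n` with the determinant of the matrix with rows `F_t^n(z,w)`, `F_t^m(z,w)` zero. -/
def LattesPreperiodic (t : ℂ) (p : ℂ × ℂ) : Prop :=
  ∃ m n : ℕ, m < n ∧
    ((LattesLift t 1)^[n] p).1 * ((LattesLift t 1)^[m] p).2 -
      ((LattesLift t 1)^[n] p).2 * ((LattesLift t 1)^[m] p).1 = 0

/-- The lift of the Lattès map with parameter `t` over an arbitrary commutative ring. -/
def lattesMap {R : Type*} [CommRing R] (t : R) (P : R × R) : R × R :=
  ((t * P.2 ^ 2 - P.1 ^ 2) ^ 2, 4 * P.1 * P.2 * (P.2 - P.1) * (t * P.2 - P.1))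

lemma lattesLift_one (t : ℂ) : LattesLift t 1 = lattesMap t := by
  funext P
  simp only [LattesLift, lattesMap, Prod.mk.injEq]
  constructor <;> ring

lemma lattesMap_map {R S : Type*} [CommRing R] [CommRing S] (φ : R →+* S) (t : R) (P : R × R) :
    Prod.map φ φ (lattesMap t P) = lattesMap (φ t) (Prod.map φ φ P) := by
  simp [lattesMap, map_ofNat φ 4]

lemma lattesMap_iterate_map {R S : Type*} [CommRing R] [CommRing S] (φ : R →+* S) (t : R)
    (n : ℕ) (P : R × R) :
    Prod.map φ φ ((lattesMap t)^[n] P) = (lattesMap (φ t))^[n] (Prod.map φ φ P) :=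
  Function.Semiconj.iterate_right (lattesMap_map φ t) n P

lemma lattesMap_iterate_mul {R : Type*} [CommRing R] (t s p q : R) (n : ℕ) :
    (lattesMap t)^[n] (s * p, s * q) =
      (s ^ 4 ^ n * ((lattesMap t)^[n] (p, q)).1, s ^ 4 ^ n * ((lattesMap t)^[n] (p, q)).2) := by
  induction n with
  | zero => simp
  | succ n ih =>
    simp only [Function.iterate_succ_apply', ih]
    simp only [lattesMap, Prod.mk.injEq, pow_succ 4 n, pow_mul]
    constructor <;> ring

lemma lattesMap_cross {R : Type*} [CommRing R] [IsDomain R] (t : R) {u v : R × R}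
    (h : u.1 * v.2 = u.2 * v.1) :
    (lattesMap t u).1 * (lattesMap t v).2 = (lattesMap t u).2 * (lattesMap t v).1 := by
  obtain ⟨a, b⟩ := u
  obtain ⟨c, d⟩ := v
  have key : ∀ r s : R, r * c = s * a → r * d = s * b → r ≠ 0 →
      (lattesMap t (a, b)).1 * (lattesMap t (c, d)).2 =
        (lattesMap t (a, b)).2 * (lattesMap t (c, d)).1 := by
    intro r s hc hd hr
    have h₁ := lattesMap_iterate_mul t r c d 1
    rw [hc, hd, lattesMap_iterate_mul t s a b 1] at h₁
    simp only [Function.iterate_one, Prod.mk.injEq] at h₁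
    apply mul_left_cancel₀ (pow_ne_zero (4 ^ 1) hr)
    linear_combination (lattesMap t (a, b)).2 * h₁.1 - (lattesMap t (a, b)).1 * h₁.2
  simp only at h
  by_cases ha : a = 0
  · by_cases hb : b = 0
    · simp [ha, hb, lattesMap]
    · exact key b d (by linear_combination -h) (by ring) hb
  · exact key a c (by ring) (by linear_combination h) ha

namespace Polynomial

/-- The pair `P` of polynomials, as a point of the projective line over `ℂ(t)`, is preperiodic
for the generic Lattès map. -/
def LattesPersistent (P : ℂ[X] × ℂ[X]) : Prop :=
  ∃ m n : ℕ, m < n ∧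
    ((lattesMap X)^[n] P).1 * ((lattesMap X)^[m] P).2 =
      ((lattesMap X)^[n] P).2 * ((lattesMap X)^[m] P).1

lemma LattesPersistent.lattesMap {P : ℂ[X] × ℂ[X]} (h : LattesPersistent P) :
    LattesPersistent (lattesMap X P) := by
  obtain ⟨m, n, hmn, h⟩ := h
  refine ⟨m, n, hmn, ?_⟩
  simp only [← Function.iterate_succ_apply]
  simp only [Function.iterate_succ_apply']
  exact lattesMap_cross X h

lemma LattesPersistent.of_mul {s p q : ℂ[X]} (hs : s ≠ 0) (h : LattesPersistent (s * p, s * q)) :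
    LattesPersistent (p, q) := by
  obtain ⟨m, n, hmn, h⟩ := h
  refine ⟨m, n, hmn, ?_⟩
  rw [lattesMap_iterate_mul, lattesMap_iterate_mul] at h
  apply mul_left_cancel₀ (pow_ne_zero (4 ^ n) hs)
  apply mul_left_cancel₀ (pow_ne_zero (4 ^ m) hs)
  linear_combination h

/-- Near a zero of `q` which is not a zero of `p`, the map multiplies the leading coefficient of
`q / p` by `4`. -/
lemma lattesMap_iterate_expansion {p q : ℂ[X]} {a k : ℂ} {r : ℕ} (hr : r ≠ 0)
    (hp : p.eval a ≠ 0) (hq : q.eval a = k * p.eval a) (n : ℕ) :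
    ∃ q' : ℂ[X], ((lattesMap X)^[n] (p, (X - C a) ^ r * q)).2 = (X - C a) ^ r * q' ∧
      ((lattesMap X)^[n] (p, (X - C a) ^ r * q)).1.eval a ≠ 0 ∧
      q'.eval a = 4 ^ n * k * ((lattesMap X)^[n] (p, (X - C a) ^ r * q)).1.eval a := by
  induction n with
  | zero => exact ⟨q, rfl, hp, by simpa using hq⟩
  | succ n ih =>
    obtain ⟨q', h₂, h₁, h₃⟩ := ih
    simp only [Function.iterate_succ_apply']
    generalize (lattesMap X)^[n] (p, (X - C a) ^ r * q) = P at h₁ h₂ h₃ ⊢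
    obtain ⟨u, v⟩ := P
    simp only at h₁ h₂ h₃
    subst h₂
    refine ⟨4 * u * q' * ((X - C a) ^ r * q' - u) * (X * ((X - C a) ^ r * q') - u), ?_, ?_, ?_⟩
    · simp only [lattesMap]
      ring
    · simpa [lattesMap, hr] using h₁
    · simp only [lattesMap, eval_mul, eval_sub, eval_pow, eval_X, eval_C, sub_self,
        zero_pow hr, eval_ofNat, h₃]
      ring

lemma not_lattesPersistent_of_root {p q : ℂ[X]} {a : ℂ} (hp : p.eval a ≠ 0) (hq : q.eval a = 0)
    (hq₀ : q ≠ 0) : ¬ LattesPersistent (p, q) := by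
  rintro ⟨m, n, hmn, h⟩
  obtain ⟨g, hg, hga⟩ := exists_eq_pow_rootMultiplicity_mul_and_not_dvd q hq₀ a
  have hr : q.rootMultiplicity a ≠ 0 := ((rootMultiplicity_pos hq₀).2 hq).ne'
  rw [dvd_iff_isRoot, IsRoot.def] at hga
  generalize q.rootMultiplicity a = r at hg hr
  subst hg
  have hk : g.eval a = g.eval a / p.eval a * p.eval a := by field_simp
  have hk₀ : g.eval a / p.eval a ≠ 0 := div_ne_zero hga hp
  generalize g.eval a / p.eval a = k at hk hk₀
  obtain ⟨u, hu, hu₁, hu₂⟩ := lattesMap_iterate_expansion hr hp hk m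
  obtain ⟨v, hv, hv₁, hv₂⟩ := lattesMap_iterate_expansion hr hp hk n
  rw [hu, hv] at h
  generalize ((lattesMap X)^[m] (p, (X - C a) ^ r * g)).1 = x at *
  generalize ((lattesMap X)^[n] (p, (X - C a) ^ r * g)).1 = y at *
  have h' : y * u = v * x := by
    apply mul_left_cancel₀ (pow_ne_zero r (X_sub_C_ne_zero a))
    linear_combination h
  have h₄ := congrArg (eval a) h'
  rw [eval_mul, eval_mul, hu₂, hv₂] at h₄
  have h₅ : (4 : ℂ) ^ m = 4 ^ n := by
    apply mul_right_cancel₀ (mul_ne_zero hk₀ (mul_ne_zero hu₁ hv₁))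
    linear_combination h₄
  have h₆ : 4 ^ m = 4 ^ n := by exact_mod_cast h₅
  exact hmn.ne (Nat.pow_right_injective (le_refl 2 |>.trans (by norm_num)) h₆)

lemma LattesPersistent.eval_ne_zero {p q : ℂ[X]} (h : LattesPersistent (p, q))
    (h₀ : p * q * (q - p) * (X * q - p) ≠ 0) {a : ℂ}
    (ha : a * q.eval a ^ 2 - p.eval a ^ 2 ≠ 0) :
    (p * q * (q - p) * (X * q - p)).eval a ≠ 0 := by
  intro hz
  refine not_lattesPersistent_of_root (a := a) ?_ ?_ ?_ h.lattesMap
  · simpa using ha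
  · have : 4 * p * q * (q - p) * (X * q - p) = 4 * (p * q * (q - p) * (X * q - p)) := by ring
    change eval a (4 * p * q * (q - p) * (X * q - p)) = 0
    rw [this, eval_mul, hz, mul_zero]
  · have : 4 * p * q * (q - p) * (X * q - p) = 4 * (p * q * (q - p) * (X * q - p)) := by ring
    simp only [this]
    exact mul_ne_zero (by norm_num) h₀

lemma exists_eq_C_of_forall_eval_ne_zero {p : ℂ[X]} (h : ∀ a, p.eval a ≠ 0) :
    ∃ b : ℂ, b ≠ 0 ∧ p = C b := by
  have hd : p.degree = 0 := by
    by_contra hd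
    obtain ⟨a, ha⟩ := IsAlgClosed.exists_root p hd
    exact h a ha
  have hC := eq_C_of_degree_eq_zero hd
  refine ⟨p.coeff 0, fun h0 ↦ h 0 ?_, hC⟩
  rw [hC, h0]
  simp

lemma LattesPersistent.eq_of_coprime {p q : ℂ[X]} (h : LattesPersistent (p, q))
    (hpq : ∀ a : ℂ, ¬ (p.eval a = 0 ∧ q.eval a = 0)) :
    p = 0 ∨ q = 0 ∨ p = q ∨ p = X * q := by
  by_contra! hne
  obtain ⟨hp, hq, h₁, ht⟩ := hne
  have h₀ : p * q * (q - p) * (X * q - p) ≠ 0 :=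
    mul_ne_zero (mul_ne_zero (mul_ne_zero hp hq) (sub_ne_zero.2 h₁.symm)) (sub_ne_zero.2 ht.symm)
  obtain ⟨b, hb, rfl⟩ := exists_eq_C_of_forall_eval_ne_zero (p := q) fun a ha ↦ by
    have hpa : p.eval a ≠ 0 := fun hpa ↦ hpq a ⟨hpa, ha⟩
    exact h.eval_ne_zero h₀ (a := a) (by simpa [ha] using hpa) (by simp [ha])
  have hroot : ∀ a : ℂ, a ≠ 0 → p.eval a ≠ 0 := fun a ha hpa ↦
    h.eval_ne_zero h₀ (a := a) (by simp [hpa, ha, hb]) (by simp [hpa])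
  obtain ⟨g, hg, hg₀⟩ := exists_eq_pow_rootMultiplicity_mul_and_not_dvd p hp 0
  rw [dvd_iff_isRoot, IsRoot.def] at hg₀
  generalize p.rootMultiplicity 0 = e at hg
  rw [C_0, sub_zero] at hg
  subst hg
  obtain ⟨c, hc, rfl⟩ := exists_eq_C_of_forall_eval_ne_zero (p := g) fun a ha ↦ by
    by_cases ha₀ : a = 0
    · exact hg₀ (ha₀ ▸ ha)
    · exact hroot a ha₀ (by simp [ha])
  obtain rfl | rfl | ⟨j, rfl⟩ : e = 0 ∨ e = 1 ∨ ∃ j, e = j + 2 := by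
    rcases e with _ | _ | j
    exacts [.inl rfl, .inr (.inl rfl), .inr (.inr ⟨j, rfl⟩)]
  · have hcb : c ≠ b := fun hcb ↦ h₁ (by simp [hcb])
    refine h.eval_ne_zero h₀ (a := c / b) ?_ ?_
    · have : c / b * b ^ 2 - c ^ 2 = c * (b - c) := by field_simp
      simpa [this, hc, sub_eq_zero] using hcb.symm
    · simp [mul_div_cancel₀ c hb]
  · have hcb : c ≠ b := fun hcb ↦ ht (by simp [hcb])
    refine h.eval_ne_zero h₀ (a := b / c) ?_ ?_
    · have : b / c * b ^ 2 - (b / c * c) ^ 2 = b ^ 2 * (b - c) / c := by field_simp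
      simp only [eval_mul, eval_X, eval_C, pow_one, this]
      exact div_ne_zero (mul_ne_zero (pow_ne_zero 2 hb) (sub_ne_zero.2 hcb.symm)) hc
    · simp [mul_div_cancel₀ b hc]
  · have h' := h.lattesMap
    have hfac : _root_.lattesMap X (X ^ (j + 2) * C c, C b) =
        (X ^ 2 * (C b ^ 2 - X ^ (2 * j + 3) * C c ^ 2) ^ 2,
          X ^ 2 * (4 * (X ^ (j + 1) * C c) * C b * (C b - X ^ (j + 2) * C c) *
            (C b - X ^ (j + 1) * C c))) := by
      simp only [_root_.lattesMap, Prod.mk.injEq]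
      constructor <;> ring
    rw [hfac] at h'
    refine not_lattesPersistent_of_root (a := 0) ?_ ?_ ?_ (h'.of_mul (pow_ne_zero 2 X_ne_zero))
    · simp [hb]
    · simp
    · intro hz
      apply h₀
      have := congrArg Prod.snd hfac
      rw [hz, mul_zero] at this
      apply mul_left_cancel₀ (show (4 : ℂ[X]) ≠ 0 by norm_num)
      simp only [_root_.lattesMap] at this
      linear_combination this

/-- If every specialization at `t ≠ 0, 1` is preperiodic, then so is the generic point. -/
lemma lattesPersistent_of_forall {p q : ℂ[X]}
    (h : ∀ t : ℂ, t ≠ 0 → t ≠ 1 → LattesPreperiodic t (p.eval t, q.eval t)) :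
    LattesPersistent (p, q) := by
  by_contra hP
  simp only [LattesPersistent, not_exists, not_and] at hP
  let D : ℕ × ℕ → ℂ[X] := fun i ↦ ((lattesMap X)^[i.2] (p, q)).1 * ((lattesMap X)^[i.1] (p, q)).2 -
      ((lattesMap X)^[i.2] (p, q)).2 * ((lattesMap X)^[i.1] (p, q)).1
  refine not_countable_complex (Set.Countable.mono (s₂ := {0, 1} ∪
    ⋃ i : ℕ × ℕ, ((D i).roots.toFinset : Set ℂ)) ?_ ?_)
  · intro t _
    by_cases ht : t = 0 ∨ t = 1
    · exact .inl ht
    push Not at ht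
    obtain ⟨m, n, hmn, hD⟩ := h t ht.1 ht.2
    refine .inr (Set.mem_iUnion.2 ⟨(m, n), ?_⟩)
    rw [Finset.mem_coe, Multiset.mem_toFinset, mem_roots (sub_ne_zero.2 (hP m n hmn)), IsRoot.def]
    have hev : ∀ i, Prod.map (evalRingHom t) (evalRingHom t) ((lattesMap X)^[i] (p, q)) =
        (LattesLift t 1)^[i] (p.eval t, q.eval t) := fun i ↦ by
      rw [lattesMap_iterate_map, lattesLift_one]
      simp
    rw [← hev, ← hev] at hD
    simpa [D] using hD
  · exact (Set.toFinite _).countable.union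
      (Set.countable_iUnion fun i ↦ (Finset.finite_toSet _).countable)

end Polynomial

/-- Dehomogenization of a binary form: substitute `(t, 1)` for the variables. -/
noncomputable def dehomogenize : MvPolynomial (Fin 2) ℂ →ₐ[ℂ] Polynomial ℂ :=
  aeval ![Polynomial.X, 1]

lemma eval_dehomogenize (c : MvPolynomial (Fin 2) ℂ) (t : ℂ) :
    (dehomogenize c).eval t = eval ![t, 1] c := by
  have : (Polynomial.aeval t).comp dehomogenize = aeval (R := ℂ) ![t, 1] := by
    ext i
    fin_cases i <;> simp [dehomogenize]
  simpa [Polynomial.coe_aeval_eq_eval, coe_aeval_eq_eval] using DFunLike.congr_fun this c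

lemma MvPolynomial.IsHomogeneous.eval_eq_pow_mul {c : MvPolynomial (Fin 2) ℂ} {k : ℕ}
    (hc : c.IsHomogeneous k) {x y : ℂ} (hy : y ≠ 0) :
    eval ![x, y] c = y ^ k * eval ![x / y, 1] c := by
  simp only [eval_eq', Finset.mul_sum, Fin.prod_univ_two, Matrix.cons_val_zero,
    Matrix.cons_val_one, one_pow, mul_one]
  refine Finset.sum_congr rfl fun d hd ↦ ?_
  have hk : d 0 + d 1 = k := by
    have := hc (mem_support_iff.1 hd)
    simpa [Finsupp.weight_apply, Finsupp.sum_fintype] using this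
  rw [← hk, div_pow, pow_add]
  field_simp

lemma MvPolynomial.IsHomogeneous.eq_zero_of_dehomogenize {c : MvPolynomial (Fin 2) ℂ} {k : ℕ}
    (hc : c.IsHomogeneous k) (h : dehomogenize c = 0) : c = 0 := by
  have hX : X 1 * c = 0 := by
    refine MvPolynomial.funext fun v ↦ ?_
    have hv : v = ![v 0, v 1] := by
      ext i
      fin_cases i <;> rfl
    by_cases hy : v 1 = 0
    · simp [hy]
    · rw [hv, eval_mul, hc.eval_eq_pow_mul hy, ← eval_dehomogenize, h]
      simp
  exact (mul_eq_zero.1 hX).resolve_left (X_ne_zero 1)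

lemma lattesPreperiodic_of_snd_eq_zero {t : ℂ} {P : ℂ × ℂ} (h : (lattesMap t P).2 = 0) :
    LattesPreperiodic t P := by
  refine ⟨1, 2, one_lt_two, ?_⟩
  rw [lattesLift_one]
  have h₂ : (lattesMap t (lattesMap t P)).2 = 0 := by
    rw [lattesMap]
    simp [h]
  simp [Function.iterate_succ_apply', h, h₂]

/-- Proposition 1.4: a marked point `c`, given by a homogeneous lift `C = (c₁,c₂)` of equal
degree with no common zero away from the origin, is persistently preperiodic for the Lattès
family (i.e. `(c₁(t,1), c₂(t,1))` is preperiodic for `F_t` for every `t ∈ ℂ \ {0,1}`) if and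
only if `c = 0`, `∞`, `1`, or `t` (i.e. `c₁ = 0`, `c₂ = 0`, `c₁ = c₂`, or `t₂c₁ = t₁c₂`). -/
theorem persistently_preperiodic_iff (c₁ c₂ : MvPolynomial (Fin 2) ℂ) (k : ℕ)
    (hc₁ : c₁.IsHomogeneous k) (hc₂ : c₂.IsHomogeneous k) (hne : ¬(c₁ = 0 ∧ c₂ = 0))
    (hnocommon : ∀ x y : ℂ, (x, y) ≠ (0, 0) →
      ¬(eval ![x, y] c₁ = 0 ∧ eval ![x, y] c₂ = 0)) :
    (∀ t : ℂ, t ≠ 0 → t ≠ 1 →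
        LattesPreperiodic t (eval ![t, 1] c₁, eval ![t, 1] c₂)) ↔
      (c₁ = 0 ∨ c₂ = 0 ∨ c₁ = c₂ ∨ X 1 * c₁ = X 0 * c₂) := by
  constructor
  · intro h
    have hP : Polynomial.LattesPersistent (dehomogenize c₁, dehomogenize c₂) :=
      Polynomial.lattesPersistent_of_forall fun t h₀ h₁ ↦ by
        simpa only [eval_dehomogenize] using h t h₀ h₁
    rcases hP.eq_of_coprime fun a ↦ by
      simpa only [eval_dehomogenize] using hnocommon a 1 (by simp) with h | h | h | h
    · exact .inl (hc₁.eq_zero_of_dehomogenize h)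
    · exact .inr (.inl (hc₂.eq_zero_of_dehomogenize h))
    · exact .inr (.inr (.inl (sub_eq_zero.1
        ((hc₁.sub hc₂).eq_zero_of_dehomogenize (by rw [map_sub, h, sub_self])))))
    · refine .inr (.inr (.inr (sub_eq_zero.1 ((((isHomogeneous_X ℂ 1).mul hc₁).sub
        ((isHomogeneous_X ℂ 0).mul hc₂)).eq_zero_of_dehomogenize ?_))))
      rw [map_sub, map_mul, map_mul, h]
      simp [dehomogenize]
  · intro h t _ _
    apply lattesPreperiodic_of_snd_eq_zero
    rcases h with rfl | rfl | rfl | h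
    · simp [lattesMap]
    · simp [lattesMap]
    · simp [lattesMap]
    · have ht := congrArg (eval ![t, 1]) h
      simp only [map_mul, eval_X, Matrix.cons_val_zero, Matrix.cons_val_one, one_mul] at ht
      simp [lattesMap, ht]
end

section
/- Let C = (c₁,c₂) be a homogeneous lift of a marked point c ∉ {0,1,t,∞}, i.e. homogeneous polynomials of equal degree in ℂ[t₁,t₂] with no common zero in ℂ² \ {(0,0)} satisfying c₁ ≠ 0, c₂ ≠ 0, c₁ ≠ c₂ and t₂c₁ ≠ t₁c₂. Suppose P₁, Q₁ are homogeneous polynomials of equal degree d in ℂ[t₁,t₂] with no common zero in ℂ² \ {(0,0)}, and g is a homogeneous polynomial with F_{t₁,t₂}(C) = (g·P₁, g·Q₁). Then: d ≥ 2, P₁(0,1) ≠ 0, P₁(1,0) ≠ 0, P₁(1,1) ≠ Q₁(1,1), and Q₁(1,0) = 0 (so t₂ divides Q₁). Moreover, defining Fₙ = (Pₙ,Qₙ) inductively by t₂²·Pₙ₊₁ = (t₁Qₙ² − t₂Pₙ²)² and t₂²·Qₙ₊₁ = 4t₂PₙQₙ(Qₙ−Pₙ)(t₁Qₙ−t₂Pₙ),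 for every n ≥ 1 the polynomials Pₙ and Qₙ are homogeneous of degree 4^{n−1}·d, t₂ divides Qₙ, and Pₙ, Qₙ have no common zero in ℂ² \ {(0,0)} (equivalently, Fₙ has nonzero resultant). (Proposition 3.1.) -/
open MvPolynomial

lemma Prime.not_dvd_sq_of_not_dvd {R : Type*} [CommRing R] {p : R} (hp : Prime p) {v e h : R}
    (hv : ¬ p ∣ v) (he : ¬ p ∣ e) :
    ¬ p ∣ (v * e ^ 2 + p * h) ^ 2 := by
  intro H
  have h1 := (dvd_add_left (dvd_mul_right p h)).1 (hp.dvd_of_dvd_pow H)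
  exact (hp.dvd_or_dvd h1).elim hv fun h2 => he (hp.dvd_of_dvd_pow h2)

section Prime

variable {R : Type*} [CommRing R] [IsDomain R] {p : R}

/-- If `p` has order at most `n` in `g * a` and at least `n` in `g * b`, and `p` does not divide
both `a` and `b`, then `p` does not divide `a`. -/
lemma Prime.not_dvd_of_pow_dvd_mul (hp : Prime p) {g a b : R} {n : ℕ}
    (hb : p ^ n ∣ g * b) (ha : ¬ p ^ (n + 1) ∣ g * a) (hab : ¬ (p ∣ a ∧ p ∣ b)) : ¬ p ∣ a := by
  intro h
  have hpb : ¬ p ∣ b := fun h' => hab ⟨h, h'⟩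
  exact ha (pow_succ p n ▸ mul_dvd_mul (hp.pow_dvd_of_dvd_mul_right n hpb hb) h)

lemma Prime.dvd_of_pow_dvd_mul (hp : Prime p) {g a b : R} {n : ℕ}
    (hb : p ^ n ∣ g * b) (ha : ¬ p ^ n ∣ g * a) : p ∣ b := by
  by_contra h
  exact ha ((hp.pow_dvd_of_dvd_mul_right n h hb).mul_right a)

lemma Prime.not_pow_three_dvd_sq (hp : Prime p) {v e h : R} (he : p ∣ e) (hh : ¬ p ∣ h) :
    ¬ p ^ 3 ∣ (v * e ^ 2 + p * h) ^ 2 := by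
  obtain ⟨e, rfl⟩ := he
  intro H
  rw [show (v * (p * e) ^ 2 + p * h) ^ 2 = p ^ 2 * (p * (v * e ^ 2) + h) ^ 2 by ring,
    pow_succ p 2, mul_dvd_mul_iff_left (pow_ne_zero 2 hp.ne_zero)] at H
  exact hh ((dvd_add_right (dvd_mul_right p _)).1 (hp.dvd_of_dvd_pow H))

/-- If `g * a` is the square of `v * e ^ 2 + p * h`, whose order at `p` is at most one, then `p`
does not divide `a` as soon as the order of `g * b` at `p` is large enough. -/
lemma Prime.not_dvd_of_mul_eq_sq (hp : Prime p) {g a b v e h : R}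
    (hga : g * a = (v * e ^ 2 + p * h) ^ 2) (hv : ¬ p ∣ v) (hh : p ∣ e → ¬ p ∣ h)
    (hb : p ∣ e → p ^ 2 ∣ g * b) (hab : ¬ (p ∣ a ∧ p ∣ b)) : ¬ p ∣ a := by
  by_cases he : p ∣ e
  · exact hp.not_dvd_of_pow_dvd_mul (hb he) (hga ▸ hp.not_pow_three_dvd_sq he (hh he)) hab
  · refine hp.not_dvd_of_pow_dvd_mul (n := 0) (g := g) (by simp) ?_ hab
    rw [hga, zero_add, pow_one]
    exact hp.not_dvd_sq_of_not_dvd hv he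

lemma Prime.dvd_of_mul_eq_sq (hp : Prime p) {g a b v e h : R}
    (hga : g * a = (v * e ^ 2 + p * h) ^ 2) (hv : ¬ p ∣ v) (hh : p ∣ e → ¬ p ∣ h)
    (hb : p ∣ g * b) (hb' : p ∣ e → p ^ 3 ∣ g * b) : p ∣ b := by
  by_cases he : p ∣ e
  · exact hp.dvd_of_pow_dvd_mul (hb' he) (hga ▸ hp.not_pow_three_dvd_sq he (hh he))
  · refine hp.dvd_of_pow_dvd_mul (n := 1) (by simpa using hb) (a := a) ?_
    rw [hga, pow_one]
    exact hp.not_dvd_sq_of_not_dvd hv he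

/-- A prime `p` divides `a` whenever both `g * p` and `g * a` are squares. -/
lemma Prime.dvd_of_mul_eq_sq_of_mul_eq_sq [WfDvdMonoid R] (hp : Prime p) {g a r s : R}
    (hg : g ≠ 0) (hr : g * p = r ^ 2) (hs : g * a = s ^ 2) : p ∣ a := by
  by_contra ha
  have ha0 : a ≠ 0 := fun h => ha (h ▸ dvd_zero p)
  have hr0 : r ≠ 0 := by
    rintro rfl
    exact mul_ne_zero hg hp.ne_zero (by simpa using hr)
  have hs0 : s ≠ 0 := by
    rintro rfl
    exact mul_ne_zero hg ha0 (by simpa using hs)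
  have key : ∀ {x : R}, x ≠ 0 → FiniteMultiplicity p x := fun hx => .of_prime_left hp hx
  have h1 := congrArg (multiplicity p) hr
  have h2 := congrArg (multiplicity p) hs
  rw [multiplicity_mul hp (key (mul_ne_zero hg hp.ne_zero)),
    (key hr0).multiplicity_pow hp, multiplicity_self] at h1
  rw [multiplicity_mul hp (key (mul_ne_zero hg ha0)), (key hs0).multiplicity_pow hp,
    multiplicity_eq_zero.2 ha] at h2
  omega

end Prime

namespace MvPolynomial

lemma IsHomogeneous.aeval_mul {σ R A : Type*} [CommSemiring R] [CommSemiring A] [Algebra R A]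
    {f : MvPolynomial σ R} {n : ℕ} (hf : f.IsHomogeneous n) (z : A) (w : σ → A) :
    MvPolynomial.aeval (fun i => z * w i) f = z ^ n * MvPolynomial.aeval w f := by
  simp only [aeval_def, eval₂_eq, Finset.mul_sum]
  refine Finset.sum_congr rfl fun m hm => ?_
  simp only [mul_pow, Finset.prod_mul_distrib, Finset.prod_pow_eq_pow_sum]
  rw [hf.degree_eq_sum_deg_support hm]
  ring

lemma IsHomogeneous.of_X_mul {σ R : Type*} [CommSemiring R] {i : σ} {f : MvPolynomial σ R} {n : ℕ}
    (h : (X i * f).IsHomogeneous (n + 1)) : f.IsHomogeneous n := by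
  intro m hm
  have h' := h (d := Finsupp.single i 1 + m) (by rwa [coeff_X_mul])
  rw [map_add] at h'
  simp only [Finsupp.weight_single, Pi.one_apply, smul_eq_mul, mul_one] at h'
  omega

variable {K : Type*} [Field K]

lemma IsHomogeneous.prime_of_degree_one {σ : Type*} {p : MvPolynomial σ K}
    (hp : p.IsHomogeneous 1) (h0 : p ≠ 0) : Prime p := by
  refine (irreducible_of_totalDegree_eq_one (hp.totalDegree h0) fun x hx => ?_).prime
  obtain ⟨m, hm⟩ := ne_zero_iff.1 h0
  exact (ne_zero_of_dvd_ne_zero hm (hx m)).isUnit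

/-- A binary form vanishing at a nonzero point is divisible by the corresponding linear form. -/
lemma IsHomogeneous.linear_dvd_of_eval_eq_zero {f : MvPolynomial (Fin 2) K} {n : ℕ}
    (hf : f.IsHomogeneous n) {x y : K} (hxy : x ≠ 0 ∨ y ≠ 0) (h : eval ![x, y] f = 0) :
    C y * X 0 - C x * X 1 ∣ f := by
  set I := Ideal.span {(C y * X 0 - C x * X 1 : MvPolynomial (Fin 2) K)} with hI
  rw [← Ideal.mem_span_singleton, ← hI, ← Ideal.Quotient.eq_zero_iff_mem]
  let π := Ideal.Quotient.mkₐ K I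
  have hrel : algebraMap K _ y * π (X 0) = algebraMap K _ x * π (X 1) := by
    have : π (C y * X 0 - C x * X 1) = 0 :=
      Ideal.Quotient.eq_zero_iff_mem.2 (Ideal.mem_span_singleton_self _)
    rw [map_sub, map_mul, map_mul, sub_eq_zero] at this
    simpa [← algebraMap_eq] using this
  have hz : ∃ z, ∀ i : Fin 2, π (X i) = z * algebraMap K _ (![x, y] i) := by
    rcases hxy with h | h
    · refine ⟨algebraMap K _ x⁻¹ * π (X 0), fun i => ?_⟩
      have hx : algebraMap K (MvPolynomial (Fin 2) K ⧸ I) x⁻¹ * algebraMap K _ x = 1 := by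
        rw [← map_mul, inv_mul_cancel₀ h, map_one]
      fin_cases i
      · simp only [Fin.zero_eta, Matrix.cons_val_zero]
        linear_combination (-π (X 0)) * hx
      · simp only [Fin.mk_one, Matrix.cons_val_one, Matrix.cons_val_fin_one]
        linear_combination (-π (X 1)) * hx - algebraMap K _ x⁻¹ * hrel
    · refine ⟨algebraMap K _ y⁻¹ * π (X 1), fun i => ?_⟩
      have hy : algebraMap K (MvPolynomial (Fin 2) K ⧸ I) y⁻¹ * algebraMap K _ y = 1 := by
        rw [← map_mul, inv_mul_cancel₀ h, map_one]
      fin_cases i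
      · simp only [Fin.zero_eta, Matrix.cons_val_zero]
        linear_combination (-π (X 0)) * hy + algebraMap K _ y⁻¹ * hrel
      · simp only [Fin.mk_one, Matrix.cons_val_one, Matrix.cons_val_fin_one]
        linear_combination (-π (X 1)) * hy
  obtain ⟨z, hz⟩ := hz
  have h1 : π f = MvPolynomial.aeval (fun i => π (X i)) f := by
    rw [← comp_aeval_apply, aeval_X_left_apply]
  change π f = 0
  rw [h1, _root_.funext hz, hf.aeval_mul]
  change z ^ n * MvPolynomial.aeval (algebraMap K _ ∘ ![x, y]) f = 0
  rw [aeval_algebraMap_apply, aeval_eq_eval]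
  simp [h]

end MvPolynomial

/-- The conditions on a pair of binary forms of degree `D` that are preserved by the rule
`(P, Q) ↦ t₂⁻² F(P, Q)`. -/
structure IsAdmissiblePair (D : ℕ) (P Q : MvPolynomial (Fin 2) ℂ) : Prop where
  left : P.IsHomogeneous D
  right : Q.IsHomogeneous D
  dvd : X 1 ∣ Q
  no_common_zero : ∀ x y : ℂ, (x, y) ≠ (0, 0) → ¬(eval ![x, y] P = 0 ∧ eval ![x, y] Q = 0)
  eval_zero_ne : ∀ y : ℂ, y ≠ 0 → eval ![0, y] P ≠ 0
  eval_diag_ne : ∀ y : ℂ, y ≠ 0 → eval ![y, y] P ≠ eval ![y, y] Q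

lemma IsAdmissiblePair.step {D : ℕ} {P Q P' Q' : MvPolynomial (Fin 2) ℂ}
    (h : IsAdmissiblePair D P Q)
    (hP' : (X 1) ^ 2 * P' = (X 0 * Q ^ 2 - X 1 * P ^ 2) ^ 2)
    (hQ' : (X 1) ^ 2 * Q' = 4 * X 1 * P * Q * (Q - P) * (X 0 * Q - X 1 * P)) :
    IsAdmissiblePair (4 * D) P' Q' := by
  obtain ⟨hP, hQ, ⟨q, hq⟩, hnc, h0, h1⟩ := h
  have hX (i : Fin 2) : (X i : MvPolynomial (Fin 2) ℂ).IsHomogeneous 1 := isHomogeneous_X ℂ i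
  have hX0 : (X 1 : MvPolynomial (Fin 2) ℂ) ^ 2 ≠ 0 := pow_ne_zero 2 (X_ne_zero 1)
  have cancel {f h : MvPolynomial (Fin 2) ℂ} {n : ℕ} (hfh : (X 1) ^ 2 * f = h)
      (hh : h.IsHomogeneous n) (hn : n = 4 * D + 2) : f.IsHomogeneous (4 * D) := by
    have hf : (X 1 * (X 1 * f)).IsHomogeneous (4 * D + 1 + 1) := by
      rwa [← mul_assoc, ← pow_two, hfh, ← hn]
    exact hf.of_X_mul.of_X_mul
  have eP : P' = (X 0 * X 1 * q ^ 2 - P ^ 2) ^ 2 := by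
    apply mul_left_cancel₀ hX0
    rw [hP', hq]
    ring
  have eQ : Q' = 4 * X 1 * P * q * (X 1 * q - P) * (X 0 * q - P) := by
    apply mul_left_cancel₀ hX0
    rw [hQ', hq]
    ring
  refine ⟨?_, ?_, ?_, ?_, ?_, ?_⟩
  · exact cancel hP' ((((hX 0).mul (hQ.pow 2)).sub ((hX 1).mul (hP.pow 2))).pow 2) (by ring)
  · have h4 : (4 : MvPolynomial (Fin 2) ℂ).IsHomogeneous 0 := by
      rw [← map_ofNat C 4]
      exact isHomogeneous_C (Fin 2) _
    exact cancel hQ' (((((h4.mul (hX 1)).mul hP).mul hQ).mul (hQ.sub hP)).mul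
      (((hX 0).mul hQ).sub ((hX 1).mul hP))) (by ring)
  · rw [eQ]
    exact ⟨4 * P * q * (X 1 * q - P) * (X 0 * q - P), by ring⟩
  · rintro x y hxy ⟨hx, hy⟩
    have hn := hnc x y hxy
    have hQv : eval ![x, y] Q = y * eval ![x, y] q := by simp [hq]
    have hzero : x = 0 → eval ![x, y] P ≠ 0 := by
      rintro rfl
      exact h0 y fun hy0 => hxy (by rw [hy0])
    have hdiag : x = y → eval ![x, y] P ≠ eval ![x, y] Q := by
      rintro rfl
      exact h1 x fun hx0 => hxy (by rw [hx0])
    rw [hQv] at hn hdiag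
    simp only [eP, eQ, map_pow, map_sub, map_mul, eval_X, Matrix.cons_val_zero,
      Matrix.cons_val_one, Matrix.cons_val_fin_one, map_ofNat] at hx hy
    generalize eval ![x, y] P = a at *
    generalize eval ![x, y] q = b at *
    have hx' : x * y * b ^ 2 = a ^ 2 := sub_eq_zero.1 (pow_eq_zero_iff two_ne_zero |>.1 hx)
    have hb : b ≠ 0 := by
      rintro rfl
      exact hn ⟨by simpa using hx'.symm, mul_zero y⟩
    have hy0 : y ≠ 0 := by
      rintro rfl
      exact hn ⟨by simpa using hx'.symm, zero_mul b⟩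
    have ha : a ≠ 0 := by
      rintro rfl
      have hx0 : x = 0 := by simpa [hb, hy0] using hx'
      exact hzero hx0 rfl
    have hx0 : x ≠ 0 := by
      rintro rfl
      exact ha (by simpa using hx'.symm)
    have key : y * b = a ∨ x * b = a := by
      simpa [hb, hy0, ha, sub_eq_zero] using hy
    rcases key with rfl | rfl
    · refine hdiag (mul_right_cancel₀ (mul_ne_zero hy0 (pow_ne_zero 2 hb)) ?_) rfl
      linear_combination hx'
    · have hxy' : x = y := by
        refine (mul_right_cancel₀ (mul_ne_zero hx0 (pow_ne_zero 2 hb)) ?_)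
        linear_combination -hx'
      exact hdiag hxy' (by rw [hxy'])
  · intro y hy
    simpa [eP] using h0 y hy
  · intro y hy heq
    have hQv : eval ![y, y] Q = y * eval ![y, y] q := by simp [hq]
    have hne := h1 y hy
    rw [hQv] at hne
    simp only [eP, eQ, map_pow, map_sub, map_mul, eval_X, Matrix.cons_val_zero,
      Matrix.cons_val_one, Matrix.cons_val_fin_one, map_ofNat] at heq
    refine hne (sub_eq_zero.1 (pow_eq_zero_iff four_ne_zero |>.1 ?_))
    linear_combination heq

/-- Proposition 3.1. Let `C = (c₁,c₂)` be a homogeneous lift of a marked point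
`c ∉ {0,1,t,∞}`, let `F₁ = (P 1, Q 1)` be homogeneous of equal degree `d` with no common
zero away from the origin such that `F_{t₁,t₂}(C) = (g·P 1, g·Q 1)` for homogeneous `g`,
and define `Fₙ = (P n, Q n)` by `t₂²·P (n+1) = (t₁(Q n)² − t₂(P n)²)²` and
`t₂²·Q (n+1) = 4t₂(P n)(Q n)(Q n − P n)(t₁(Q n) − t₂(P n))`.  Then `d ≥ 2`,
`P₁(0,1) ≠ 0`, `P₁(1,0) ≠ 0`, `P₁(1,1) ≠ Q₁(1,1)`, `Q₁(1,0) = 0` (so `t₂ ∣ Q₁`), and for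
each `n ≥ 1` the polynomials `P n, Q n` are homogeneous of degree `4^(n−1)·d`, `t₂ ∣ Q n`,
and `P n, Q n` have no common zero in `ℂ² \ {(0,0)}`. -/
theorem first_iterate_properties
    (c₁ c₂ : MvPolynomial (Fin 2) ℂ) (k : ℕ)
    (hc₁ : c₁.IsHomogeneous k) (hc₂ : c₂.IsHomogeneous k)
    (hCnocommon : ∀ x y : ℂ, (x, y) ≠ (0, 0) →
      ¬(eval ![x, y] c₁ = 0 ∧ eval ![x, y] c₂ = 0))
    (hc₁0 : c₁ ≠ 0) (hc₂0 : c₂ ≠ 0) (hc₁₂ : c₁ ≠ c₂) (hct : X 1 * c₁ ≠ X 0 * c₂)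
    (P Q : ℕ → MvPolynomial (Fin 2) ℂ) (d : ℕ)
    (hP1 : (P 1).IsHomogeneous d) (hQ1 : (Q 1).IsHomogeneous d)
    (hPQnocommon : ∀ x y : ℂ, (x, y) ≠ (0, 0) →
      ¬(eval ![x, y] (P 1) = 0 ∧ eval ![x, y] (Q 1) = 0))
    (g : MvPolynomial (Fin 2) ℂ) (m : ℕ) (hg : g.IsHomogeneous m)
    (hgP : (X 0 * c₂ ^ 2 - X 1 * c₁ ^ 2) ^ 2 = g * P 1)
    (hgQ : 4 * X 1 * c₁ * c₂ * (c₂ - c₁) * (X 0 * c₂ - X 1 * c₁) = g * Q 1)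
    (hrecP : ∀ n, 1 ≤ n →
      (X 1) ^ 2 * P (n + 1) = (X 0 * (Q n) ^ 2 - X 1 * (P n) ^ 2) ^ 2)
    (hrecQ : ∀ n, 1 ≤ n →
      (X 1) ^ 2 * Q (n + 1) =
        4 * X 1 * P n * Q n * (Q n - P n) * (X 0 * Q n - X 1 * P n)) :
    2 ≤ d ∧
    eval ![0, 1] (P 1) ≠ 0 ∧
    eval ![1, 0] (P 1) ≠ 0 ∧
    eval ![1, 1] (P 1) ≠ eval ![1, 1] (Q 1) ∧
    eval ![1, 0] (Q 1) = 0 ∧ X 1 ∣ Q 1 ∧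
    ∀ n, 1 ≤ n →
      (P n).IsHomogeneous (4 ^ (n - 1) * d) ∧
      (Q n).IsHomogeneous (4 ^ (n - 1) * d) ∧
      X 1 ∣ Q n ∧
      ∀ x y : ℂ, (x, y) ≠ (0, 0) →
        ¬(eval ![x, y] (P n) = 0 ∧ eval ![x, y] (Q n) = 0) := by
  have hX (i : Fin 2) : (X i : MvPolynomial (Fin 2) ℂ).IsHomogeneous 1 := isHomogeneous_X ℂ i
  have not_dvd {a b p : MvPolynomial (Fin 2) ℂ} {x y : ℂ} (hxy : (x, y) ≠ (0, 0))
      (hp : eval ![x, y] p = 0)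
      (hab : ∀ x y : ℂ, (x, y) ≠ (0, 0) → ¬(eval ![x, y] a = 0 ∧ eval ![x, y] b = 0)) :
      ¬ (p ∣ a ∧ p ∣ b) := by
    rintro ⟨⟨r, rfl⟩, ⟨s, rfl⟩⟩
    exact hab x y hxy (by simp [hp])
  have ht0 : Prime (X 0 : MvPolynomial (Fin 2) ℂ) := (hX 0).prime_of_degree_one (X_ne_zero 0)
  have ht1 : Prime (X 1 : MvPolynomial (Fin 2) ℂ) := (hX 1).prime_of_degree_one (X_ne_zero 1)
  have hsub0 : (X 0 - X 1 : MvPolynomial (Fin 2) ℂ) ≠ 0 := by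
    intro h
    simpa using congrArg (eval ![1, 0]) h
  have ht : Prime (X 0 - X 1 : MvPolynomial (Fin 2) ℂ) :=
    ((hX 0).sub (hX 1)).prime_of_degree_one hsub0
  have h01 : ¬ (X 0 : MvPolynomial (Fin 2) ℂ) ∣ X 1 := by
    rintro ⟨r, h⟩
    simpa using congrArg (eval ![0, 1]) h
  have h10 : ¬ (X 1 : MvPolynomial (Fin 2) ℂ) ∣ X 0 := by
    rintro ⟨r, h⟩
    simpa using congrArg (eval ![1, 0]) h
  have hs1 : ¬ (X 0 - X 1 : MvPolynomial (Fin 2) ℂ) ∣ X 1 := by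
    rintro ⟨r, h⟩
    simpa using congrArg (eval ![1, 1]) h
  have hgQ0 : g * Q 1 ≠ 0 := by
    rw [← hgQ]
    refine mul_ne_zero (mul_ne_zero (mul_ne_zero (mul_ne_zero (mul_ne_zero ?_ (X_ne_zero 1)) hc₁0)
      hc₂0) (sub_ne_zero.2 hc₁₂.symm)) (sub_ne_zero.2 hct.symm)
    rw [← map_ofNat C 4]
    exact C_ne_zero.2 (by norm_num)
  have hgPQ : g * (P 1 - Q 1) = (X 1 * (c₁ - c₂) ^ 2 + (X 0 - X 1) * c₂ ^ 2) ^ 2 := by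
    linear_combination hgQ - hgP
  have hgP' : g * P 1 = (-X 1 * c₁ ^ 2 + X 0 * c₂ ^ 2) ^ 2 := by
    linear_combination - hgP
  have hgP'' : g * P 1 = (X 0 * c₂ ^ 2 + X 1 * -c₁ ^ 2) ^ 2 := by
    linear_combination - hgP
  have hP0 : ¬ X 0 ∣ P 1 := by
    refine ht0.not_dvd_of_mul_eq_sq hgP' (by rwa [dvd_neg]) (fun h h' => ?_) (fun h => ?_)
      (not_dvd (x := 0) (y := 1) (by simp) (by simp) hPQnocommon)
    · exact not_dvd (x := 0) (y := 1) (by simp) (by simp) hCnocommon ⟨h, ht0.dvd_of_dvd_pow h'⟩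
    · obtain ⟨r, rfl⟩ := h
      exact ⟨4 * X 1 * r * c₂ * (c₂ - X 0 * r) * (c₂ - X 1 * r), by rw [← hgQ]; ring⟩
  have hPQ : ¬ (X 0 - X 1) ∣ P 1 - Q 1 := by
    refine ht.not_dvd_of_mul_eq_sq (b := Q 1) hgPQ hs1 (fun h h' => ?_) (fun h => ?_) ?_
    · have h2 := ht.dvd_of_dvd_pow h'
      exact not_dvd (x := 1) (y := 1) (by simp) (by simp) hCnocommon
        ⟨(dvd_iff_dvd_of_dvd_sub h).2 h2, h2⟩
    · obtain ⟨r, hr⟩ := h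
      obtain rfl : c₁ = c₂ + (X 0 - X 1) * r := by linear_combination hr
      exact ⟨4 * X 1 * (c₂ + (X 0 - X 1) * r) * c₂ * (-r) * (c₂ - X 1 * r), by
        rw [← hgQ]; ring⟩
    · rintro ⟨h, h'⟩
      exact not_dvd (x := 1) (y := 1) (by simp) (by simp) hPQnocommon
        ⟨(dvd_iff_dvd_of_dvd_sub h).2 h', h'⟩
  have hQ0 : X 1 ∣ Q 1 := by
    refine ht1.dvd_of_mul_eq_sq hgP'' h10 (fun h h' => ?_) ?_ (fun h => ?_)
    · exact not_dvd (x := 1) (y := 0) (by simp) (by simp) hCnocommon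
        ⟨ht1.dvd_of_dvd_pow (dvd_neg.1 h'), h⟩
    · exact ⟨4 * c₁ * c₂ * (c₂ - c₁) * (X 0 * c₂ - X 1 * c₁), by rw [← hgQ]; ring⟩
    · obtain ⟨r, rfl⟩ := h
      exact ⟨4 * c₁ * r * (X 1 * r - c₁) * (X 0 * r - c₁), by rw [← hgQ]; ring⟩
  have hQ10 : eval ![1, 0] (Q 1) = 0 := by
    obtain ⟨r, hr⟩ := hQ0
    simp [hr]
  have hP10 : eval ![1, 0] (P 1) ≠ 0 := fun h => hPQnocommon 1 0 (by simp) ⟨h, hQ10⟩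
  have hP0y : ∀ y : ℂ, y ≠ 0 → eval ![0, y] (P 1) ≠ 0 := by
    intro y hy h
    have := hP1.linear_dvd_of_eval_eq_zero (.inr hy) h
    rw [C_0, zero_mul, sub_zero] at this
    exact hP0 (dvd_of_mul_left_dvd this)
  have hPQy : ∀ y : ℂ, y ≠ 0 → eval ![y, y] (P 1) ≠ eval ![y, y] (Q 1) := by
    intro y hy h
    have := (hP1.sub hQ1).linear_dvd_of_eval_eq_zero (.inr hy) (by rw [map_sub, h, sub_self])
    rw [← mul_sub] at this
    exact hPQ (dvd_of_mul_left_dvd this)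
  have hg0 : g ≠ 0 := left_ne_zero_of_mul hgQ0
  have hQne : Q 1 ≠ 0 := right_ne_zero_of_mul hgQ0
  have hPne : P 1 ≠ 0 := fun h => hP10 (by rw [h, map_zero])
  have hconst (r : MvPolynomial (Fin 2) ℂ) (hr : r.totalDegree = 0) (h : eval ![1, 0] r = 0) :
      r = 0 := by
    rw [totalDegree_eq_zero_iff_eq_C] at hr
    rw [hr, eval_C] at h
    rw [hr, h, C_0]
  have hd : 2 ≤ d := by
    by_contra! hlt
    interval_cases d
    · exact hQne (hconst _ (hQ1.totalDegree hQne) hQ10)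
    · have hdvd : P 1 ∣ P 1 - Q 1 :=
        (hP1.prime_of_degree_one hPne).dvd_of_mul_eq_sq_of_mul_eq_sq hg0 hgP' hgPQ
      obtain ⟨r, hr⟩ := (dvd_sub_right (dvd_refl (P 1))).1 hdvd
      have hr0 : r ≠ 0 := right_ne_zero_of_mul (hr ▸ hQne)
      have hdeg := totalDegree_mul_of_isDomain hPne hr0
      rw [← hr, hQ1.totalDegree hQne, hP1.totalDegree hPne] at hdeg
      refine hr0 (hconst r (by omega) ?_)
      rw [hr, map_mul] at hQ10
      exact (mul_eq_zero.1 hQ10).resolve_left hP10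
  refine ⟨hd, hP0y 1 one_ne_zero, hP10, hPQy 1 one_ne_zero, hQ10, hQ0, fun n hn => ?_⟩
  have key : IsAdmissiblePair (4 ^ (n - 1) * d) (P n) (Q n) := by
    induction n, hn using Nat.le_induction with
    | base => simpa using ⟨hP1, hQ1, hQ0, hPQnocommon, hP0y, hPQy⟩
    | succ n hn ih =>
      have h := ih.step (hrecP n hn) (hrecQ n hn)
      rwa [← mul_assoc, ← pow_succ', show n - 1 + 1 = n + 1 - 1 by omega] at h
  exact ⟨key.left, key.right, key.dvd, key.no_common_zero⟩
end

section
/- Let c ∈ ℂ(t) be a marked point with c ∉ {0,1,t}, represented by a homogeneous lift C = (c₁,c₂). Then the set of parameters t ∈ ℂ \ {0,1} for which the point (c₁(t,1), c₂(t,1)) is preperiodic for F_t is infinite. Equivalently, there are infinitely many t ∈ ℂ \ {0,1} for which c(t) determines a torsion point on the Legendre curve E_t. (Infinitude of Tor(c), proved in Section 6.5 via Montel's theorem.) -/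
open MvPolynomial

namespace Polynomial

/-- The radical of a complex polynomial has degree at most the
size of any finite set containing its roots. -/
theorem natDegree_radical_le_card {p : ℂ[X]} (hp : p ≠ 0) (U : Finset ℂ)
    (hU : ∀ x, p.eval x = 0 → x ∈ U) :
    (UniqueFactorizationMonoid.radical p).natDegree ≤ U.card := by
  have hdvd := UniqueFactorizationMonoid.radical_dvd_self (a := p)
  have h0 : UniqueFactorizationMonoid.radical p ≠ 0 := ne_zero_of_dvd_ne_zero hp hdvd
  have hsq : Squarefree (UniqueFactorizationMonoid.radical p) :=
    UniqueFactorizationMonoid.squarefree_radical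
  have hsep : (UniqueFactorizationMonoid.radical p).Separable :=
    PerfectField.separable_iff_squarefree.mpr hsq
  rw [(IsAlgClosed.splits (UniqueFactorizationMonoid.radical p)).natDegree_eq_card_roots,
    ← Multiset.toFinset_card_of_nodup (nodup_roots hsep)]
  refine Finset.card_le_card fun x hx ↦ hU x ?_
  rw [Multiset.mem_toFinset, mem_roots h0] at hx
  exact eval_eq_zero_of_dvd_of_eval_eq_zero hdvd hx

theorem roots_le_nsmul {p : ℂ[X]} {U : Finset ℂ} {N : ℕ} (hdeg : p.natDegree ≤ N)
    (hU : ∀ x, p.eval x = 0 → x ∈ U) : p.roots ≤ N • U.val := by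
  classical
  rw [Multiset.le_iff_count]
  intro x
  by_cases hx : x ∈ p.roots
  · have hxU : x ∈ U.val := hU x (mem_roots'.mp hx).2
    rw [Multiset.count_nsmul, Multiset.count_eq_one_of_mem U.nodup hxU, mul_one]
    exact (Multiset.count_le_card x _).trans ((card_roots' p).trans hdeg)
  · simp [Multiset.count_eq_zero_of_notMem hx]

theorem exists_eq_C_mul_of_roots_eq {p q : ℂ[X]} (hp : p ≠ 0) (h : p.roots = q.roots) :
    ∃ a : ℂ, q = C a * p := by
  refine ⟨q.leadingCoeff / p.leadingCoeff, ?_⟩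
  have hp' := (IsAlgClosed.splits p).eq_prod_roots
  have hq' := (IsAlgClosed.splits q).eq_prod_roots
  have hlc : p.leadingCoeff ≠ 0 := leadingCoeff_ne_zero.mpr hp
  rw [← h] at hq'
  calc q = C q.leadingCoeff * (p.roots.map fun x ↦ X - C x).prod := hq'
    _ = C (q.leadingCoeff / p.leadingCoeff) *
        (C p.leadingCoeff * (p.roots.map fun x ↦ X - C x).prod) := by
      rw [← mul_assoc, ← C_mul, div_mul_cancel₀ _ hlc]
    _ = C (q.leadingCoeff / p.leadingCoeff) * p := by rw [← hp']

end Polynomial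

namespace RatFunc

open Polynomial in
/-- Finiteness of the nonconstant solutions of the unit equation over `ℂ(t)`: finitely many
nonconstant rational functions omit the values `0`, `1`, `∞` outside a given finite set. -/
theorem finite_nonconstant_units (U : Finset ℂ) :
    {f : RatFunc ℂ | f ∉ Set.range (RatFunc.C (K := ℂ)) ∧ ∀ x ∉ U,
      f.num.eval x ≠ 0 ∧ f.denom.eval x ≠ 0 ∧ (f.denom - f.num).eval x ≠ 0}.Finite := by
  have key : ∀ f : RatFunc ℂ, f ∉ Set.range (RatFunc.C (K := ℂ)) →
      f.num ≠ 0 ∧ f.denom ≠ 0 ∧ f.denom - f.num ≠ 0 := by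
    intro f hf
    refine ⟨fun h ↦ hf ⟨0, ?_⟩, f.denom_ne_zero, fun h ↦ hf ⟨1, ?_⟩⟩
    · rw [map_zero, (num_eq_zero_iff).mp h]
    · rw [map_one, ← num_div_denom f, ← sub_eq_zero.mp h, div_self]
      simpa using f.denom_ne_zero
  set N := U.card
  refine Set.Finite.of_finite_image (f := fun f : RatFunc ℂ ↦
    (f.num.roots, f.denom.roots, (f.denom - f.num).roots)) ?_ ?_
  · refine ((Set.finite_Iic (N • U.val)).prod ((Set.finite_Iic (N • U.val)).prod
      (Set.finite_Iic (N • U.val)))).subset ?_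
    rintro _ ⟨f, ⟨hf, hU⟩, rfl⟩
    obtain ⟨hn, hd, hs⟩ := key f hf
    have hcop : IsCoprime f.num (f.denom - f.num) := by
      have := (isCoprime_num_denom f).add_mul_left_right (-1)
      rwa [mul_neg_one, ← sub_eq_add_neg] at this
    have hrad : (UniqueFactorizationMonoid.radical
        (f.num * (f.denom - f.num) * (-f.denom))).natDegree ≤ N := by
      refine natDegree_radical_le_card (mul_ne_zero (mul_ne_zero hn hs) (neg_ne_zero.mpr hd)) U ?_
      intro x hx
      by_contra hxU
      obtain ⟨h1, h2, h3⟩ := hU x hxU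
      rw [Polynomial.eval_mul, Polynomial.eval_mul, Polynomial.eval_neg] at hx
      exact mul_ne_zero (mul_ne_zero h1 h3) (neg_ne_zero.mpr h2) hx
    have hdeg : f.num.natDegree ≤ N ∧ f.denom.natDegree ≤ N ∧
        (f.denom - f.num).natDegree ≤ N := by
      rcases Polynomial.abc hn hs (neg_ne_zero.mpr hd) hcop (by ring) with h | h
      · rw [natDegree_neg] at h
        omega
      · obtain ⟨h1, h2, h3⟩ := h
        rw [derivative_neg, neg_eq_zero] at h3
        simp [derivative_eq_zero.mp h1,
          derivative_eq_zero.mp h2, derivative_eq_zero.mp h3]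
    refine ⟨roots_le_nsmul hdeg.1 ?_, roots_le_nsmul hdeg.2.1 ?_, roots_le_nsmul hdeg.2.2 ?_⟩ <;>
      intro x hx <;> by_contra hxU
    · exact (hU x hxU).1 hx
    · exact (hU x hxU).2.1 hx
    · exact (hU x hxU).2.2 hx
  · rintro f ⟨hf, -⟩ g ⟨-, -⟩ hfg
    simp only [Prod.mk.injEq] at hfg
    obtain ⟨hn, hd, hs⟩ := key f hf
    obtain ⟨a, ha⟩ := exists_eq_C_mul_of_roots_eq hn hfg.1
    obtain ⟨b, hb⟩ := exists_eq_C_mul_of_roots_eq hd hfg.2.1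
    obtain ⟨e, he⟩ := exists_eq_C_mul_of_roots_eq hs hfg.2.2
    have hb1 : b = 1 := by
      have := congrArg leadingCoeff hb
      simpa [leadingCoeff_mul, (monic_denom f).leadingCoeff, (monic_denom g).leadingCoeff]
        using this.symm
    subst hb1
    rw [map_one, one_mul] at hb
    rw [ha, hb] at he
    have hlin : Polynomial.C (1 - e) * f.denom = Polynomial.C (a - e) * f.num := by
      simp only [map_sub, map_one]
      linear_combination he
    have hae : a = e := by
      by_contra hne
      refine hf ⟨(1 - e) / (a - e), ?_⟩
      have hne' : a - e ≠ 0 := sub_ne_zero.mpr hne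
      have hnum : f.num = Polynomial.C ((1 - e) / (a - e)) * f.denom := by
        rw [div_eq_inv_mul, Polynomial.C_mul, mul_assoc, hlin, ← mul_assoc, ← Polynomial.C_mul, inv_mul_cancel₀ hne',
          Polynomial.C_1, one_mul]
      rw [← num_div_denom f, hnum, map_mul, algebraMap_C, mul_div_cancel_right₀]
      simpa using f.denom_ne_zero
    have he1 : e = 1 := by
      rw [hae, sub_self, Polynomial.C_0, zero_mul, mul_eq_zero, Polynomial.C_eq_zero] at hlin
      exact (sub_eq_zero.mp (hlin.resolve_right hd)).symm
    rw [← num_div_denom f, ← num_div_denom g, ha, hb, hae, he1, Polynomial.C_1, one_mul]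

end RatFunc

section LattesPolynomials

open Polynomial

/-- The Lattès lift `F_{X,1}` acting on pairs of polynomials in the parameter. -/
noncomputable def lattesPolyLift (p : ℂ[X] × ℂ[X]) : ℂ[X] × ℂ[X] :=
  ((Polynomial.X * p.2 ^ 2 - p.1 ^ 2) ^ 2,
    4 * p.1 * p.2 * (p.2 - p.1) * (Polynomial.X * p.2 - p.1))

theorem lattesLift_iterate_eval (t : ℂ) (p : ℂ[X] × ℂ[X]) (n : ℕ) :
    (LattesLift t 1)^[n] (p.1.eval t, p.2.eval t) =
      ((lattesPolyLift^[n] p).1.eval t, (lattesPolyLift^[n] p).2.eval t) := by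
  induction n generalizing p with
  | zero => rfl
  | succ n ih =>
    rw [Function.iterate_succ_apply, Function.iterate_succ_apply, ← ih]
    congr 1
    simp [LattesLift, lattesPolyLift]

theorem infinite_setOf_lattesPreperiodic (p : ℂ[X] × ℂ[X]) :
    {t : ℂ | t ≠ 0 ∧ t ≠ 1 ∧ LattesPreperiodic t (p.1.eval t, p.2.eval t)}.Infinite := by
  intro hS
  set S := {t : ℂ | t ≠ 0 ∧ t ≠ 1 ∧ LattesPreperiodic t (p.1.eval t, p.2.eval t)}
  set U : Finset ℂ := hS.toFinset ∪ {0, 1} with hUdef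
  set A : ℕ → ℂ[X] := fun n ↦ (lattesPolyLift^[n] p).1 with hA
  set B : ℕ → ℂ[X] := fun n ↦ (lattesPolyLift^[n] p).2 with hB
  have hBsucc (n) : B (n + 1) =
      4 * A n * B n * (B n - A n) * (Polynomial.X * B n - A n) := by
    simp only [hA, hB, Function.iterate_succ_apply']
    rfl
  have mem_U {t : ℂ} {m n : ℕ} (hmn : m < n)
      (h : (A n).eval t * (B m).eval t - (B n).eval t * (A m).eval t = 0) : t ∈ U := by
    by_contra ht
    simp only [hUdef, Finset.mem_union, Set.Finite.mem_toFinset, Finset.mem_insert,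
      Finset.mem_singleton, not_or] at ht
    refine ht.1 ⟨ht.2.1, ht.2.2, m, n, hmn, ?_⟩
    simpa only [lattesLift_iterate_eval] using h
  obtain ⟨z, hz⟩ := U.exists_notMem
  have hne {m n : ℕ} (hmn : m < n) : A n * B m ≠ B n * A m := fun h ↦
    hz (mem_U hmn (by rw [← Polynomial.eval_mul, ← Polynomial.eval_mul, h, sub_self]))
  have hBU {n : ℕ} {t : ℂ} (ht : t ∉ U) : (B n).eval t ≠ 0 := fun h ↦
    ht (mem_U n.lt_succ_self (by simp [hBsucc, h]))
  have hfactors {n : ℕ} {t : ℂ} (ht : t ∉ U) : (A n).eval t ≠ 0 ∧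
      (B n).eval t - (A n).eval t ≠ 0 ∧ t * (B n).eval t - (A n).eval t ≠ 0 := by
    have h := hBU (n := n + 1) ht
    simp only [hBsucc, Polynomial.eval_mul, Polynomial.eval_sub, Polynomial.eval_X, mul_ne_zero_iff] at h
    exact ⟨h.1.1.1.2, h.1.2, h.2⟩
  have hB0 (n) : B n ≠ 0 := fun h ↦ hBU (n := n) hz (by rw [h, Polynomial.eval_zero])
  let f : ℕ → RatFunc ℂ := fun n ↦
    algebraMap ℂ[X] (RatFunc ℂ) (A n) / algebraMap ℂ[X] (RatFunc ℂ) (B n)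
  have hcross (n) : A n * (f n).denom = (f n).num * B n :=
    ((RatFunc.num_mul_eq_mul_denom_iff (hB0 n)).mpr rfl).symm
  have hfinj : Function.Injective f := by
    intro m n hmn
    have hB0' (n) : algebraMap ℂ[X] (RatFunc ℂ) (B n) ≠ 0 := by simpa using hB0 n
    have h : A m * B n = A n * B m := by
      apply IsFractionRing.injective ℂ[X] (RatFunc ℂ)
      rw [map_mul, map_mul]
      exact (div_eq_div_iff (hB0' m) (hB0' n)).mp hmn
    rcases lt_trichotomy m n with hlt | heq | hlt
    · exact absurd (by rw [← h, mul_comm]) (hne hlt)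
    · exact heq
    · exact absurd (by rw [h, mul_comm]) (hne hlt)
  refine Set.infinite_range_of_injective hfinj
    (((RatFunc.finite_nonconstant_units U).union
      (U.finite_toSet.image (RatFunc.C (K := ℂ)))).subset ?_)
  rintro _ ⟨n, rfl⟩
  by_cases hconst : f n ∈ Set.range (RatFunc.C (K := ℂ))
  · right
    obtain ⟨a, ha⟩ := hconst
    refine ⟨a, ?_, ha⟩
    by_contra haU
    refine (hfactors (n := n) haU).2.2 ?_
    have h := hcross n
    rw [← ha] at h
    simp only [RatFunc.denom_C, RatFunc.num_C, mul_one] at h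
    simp [h]
  · left
    refine ⟨hconst, fun x hx ↦ ?_⟩
    have hd : (f n).denom.eval x ≠ 0 := fun h ↦ hBU (n := n) hx
      (eval_eq_zero_of_dvd_of_eval_eq_zero (RatFunc.denom_div_dvd (A n) (B n)) h)
    have h := congrArg (eval x) (hcross n)
    rw [Polynomial.eval_mul, Polynomial.eval_mul] at h
    refine ⟨fun h0 ↦ ?_, hd, fun h0 ↦ ?_⟩
    · rw [h0, zero_mul] at h
      exact mul_ne_zero (hfactors hx).1 hd h
    · rw [Polynomial.eval_sub, sub_eq_zero] at h0
      rw [← h0] at h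
      exact mul_ne_zero (hfactors hx).2.1 hd (by linear_combination -h)

end LattesPolynomials

/-- Infinitude of `Tor(c)` (Section 6.5): for a marked point `c ∈ ℂ(t) \ {0,1,t}`, given
by a homogeneous lift `C = (c₁,c₂)` with `c₁ ≠ 0`, `c₂ ≠ 0`, `c₁ ≠ c₂`, `t₂c₁ ≠ t₁c₂`,
the set of parameters `t ∈ ℂ \ {0,1}` for which `(c₁(t,1), c₂(t,1))` is preperiodic for
`F_t` — equivalently, `c(t)` determines a torsion point on the Legendre curve `E_t` — is
infinite. -/
theorem preperiodic_parameters_infinite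
    (c₁ c₂ : MvPolynomial (Fin 2) ℂ) (k : ℕ)
    (hc₁ : c₁.IsHomogeneous k) (hc₂ : c₂.IsHomogeneous k)
    (hnocommon : ∀ x y : ℂ, (x, y) ≠ (0, 0) →
      ¬(eval ![x, y] c₁ = 0 ∧ eval ![x, y] c₂ = 0))
    (hc₁0 : c₁ ≠ 0) (hc₂0 : c₂ ≠ 0) (hc₁₂ : c₁ ≠ c₂) (hct : X 1 * c₁ ≠ X 0 * c₂) :
    {t : ℂ | t ≠ 0 ∧ t ≠ 1 ∧
      LattesPreperiodic t (eval ![t, 1] c₁, eval ![t, 1] c₂)}.Infinite := by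
  have heval (c : MvPolynomial (Fin 2) ℂ) (t : ℂ) :
      (aeval ![(Polynomial.X : Polynomial ℂ), 1] c).eval t = eval ![t, 1] c := by
    induction c using MvPolynomial.induction_on with
    | C a => simp
    | add p q hp hq => simp [hp, hq]
    | mul_X p i hp => fin_cases i <;> simp [hp]
  simpa only [heval] using infinite_setOf_lattesPreperiodic
    (aeval ![(Polynomial.X : Polynomial ℂ), 1] c₁, aeval ![(Polynomial.X : Polynomial ℂ), 1] c₂)
end
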